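/- The value function V is a viscosity supersolution of the Hamilton–Jacobi–Bellman equation V_t(t,x) + sup_{u∈U} ( ⟨V_x(t,x), f(x,u)⟩ − L(x,u,t) ) = 0 on (0,T) × ℝⁿ: for every C¹ test function φ on (0,T) × ℝⁿ and every point (t₀,x₀) at which V − φ attains a local minimum, one has φ_t(t₀,x₀) + H(x₀, φ_x(t₀,x₀), t₀) ≥ 0, where H(x,p,t) = sup_{u∈U} ( ⟨p, f(x,u)⟩ − L(x,u,t) ). -/

import Mathlib

open MeasureTheory Set
open scoped RealInnerProductSpace

noncomputable section

/-- Euclidean state space `ℝⁿ`. -/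
abbrev En (n : ℕ) := EuclideanSpace ℝ (Fin n)

/-- An admissible control–trajectory pair on `[a,b]`. -/
def IsAdmissible {n m : ℕ} (f : En n → En m → En n) (U : Set (En m)) (a b : ℝ)
    (u : ℝ → En m) (γ : ℝ → En n) : Prop :=
  Measurable u ∧ (∀ s ∈ Icc a b, u s ∈ U) ∧ ContinuousOn γ (Icc a b) ∧
    ∀ s ∈ Icc a b, γ s = γ a + ∫ r in a..s, f (γ r) (u r)

/-- The value function of the Bolza problem. -/
def valueFun {n m : ℕ} (f : En n → En m → En n) (U : Set (En m))
    (L : En n → En m → ℝ → ℝ) (I : En n → ℝ) (t : ℝ) (x : En n) : ℝ :=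
  sInf { J | ∃ u γ, IsAdmissible f U 0 t u γ ∧ γ t = x ∧
      J = (∫ s in (0:ℝ)..t, L (γ s) (u s) s) + I (γ 0) }

/-- The Hamiltonian `H(x,p,t) = sup_{u ∈ U} (⟨p, f(x,u)⟩ - L(x,u,t))`. -/
def ham {n m : ℕ} (f : En n → En m → En n) (U : Set (En m))
    (L : En n → En m → ℝ → ℝ) (x p : En n) (t : ℝ) : ℝ :=
  sSup { r | ∃ u ∈ U, r = ⟪p, f x u⟫ - L x u t }

/-- Backward Picard-Lindelöf on a short interval, in integral form. -/
lemma exists_backward_integral_curve_of_mul_le {E : Type*} [NormedAddCommGroup E]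
    [NormedSpace ℝ E] [CompleteSpace E] {g : E → E} {K : NNReal} (hg : LipschitzWith K g)
    {a b : ℝ} (hab : a ≤ b) (hK : K * (b - a) ≤ 1 / 2) (x : E) :
    ∃ γ : ℝ → E, ContinuousOn γ (Icc a b) ∧ γ b = x ∧
      ∀ s ∈ Icc a b, γ s = γ a + ∫ r in a..s, g (γ r) := by
  have hba : 0 ≤ b - a := sub_nonneg.2 hab
  let ρ : NNReal := ⟨2 * (b - a) * ‖g x‖, by positivity⟩
  let B : NNReal := ‖g x‖₊ + K * ρ
  have hpl : IsPicardLindelof (fun _ : ℝ => g) (⟨b, right_mem_Icc.2 hab⟩ : Icc a b) x ρ 0 B K := by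
    refine ⟨fun t _ => hg.lipschitzOnWith, fun y _ => continuousOn_const, fun t _ y hy => ?_, ?_⟩
    · have h1 : ‖g y - g x‖ ≤ K * ρ := by
        rw [← dist_eq_norm]
        exact (hg.dist_le_mul y x).trans (by gcongr; exact hy)
      have h2 := norm_add_le (g y - g x) (g x)
      rw [sub_add_cancel] at h2
      simp only [B, NNReal.coe_add, NNReal.coe_mul, coe_nnnorm]
      linarith
    · have hρ : (ρ : ℝ) = 2 * (b - a) * ‖g x‖ := rfl
      simp only [B, NNReal.coe_add, NNReal.coe_mul, coe_nnnorm, NNReal.coe_zero, sub_self, sub_zero,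
        max_eq_right hba]
      have := mul_le_mul_of_nonneg_right hK ρ.2
      change _ * (ρ : ℝ) ≤ _ * (ρ : ℝ) at this
      nlinarith
  obtain ⟨γ, hγb, hγ⟩ := hpl.exists_eq_forall_mem_Icc_hasDerivWithinAt₀
  have hc : ContinuousOn γ (Icc a b) := fun s hs => (hγ s hs).continuousWithinAt
  refine ⟨γ, hc, hγb, fun s hs => ?_⟩
  have hsub : Icc a s ⊆ Icc a b := Icc_subset_Icc_right hs.2
  have hgc : ContinuousOn (fun r => g (γ r)) (Icc a s) :=
    hg.continuous.comp_continuousOn (hc.mono hsub)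
  have h := intervalIntegral.integral_eq_sub_of_hasDerivAt_of_le hs.1 (hc.mono hsub)
    (f' := fun r => g (γ r))
    (fun r hr => (hγ r (hsub (Ioo_subset_Icc_self hr))).hasDerivAt
      (Icc_mem_nhds hr.1 (hr.2.trans_le hs.2)))
    (hgc.intervalIntegrable_of_Icc hs.1)
  rw [h]
  abel

/-- Global backward existence for a Lipschitz autonomous vector field, in integral form. -/
lemma exists_backward_integral_curve {E : Type*} [NormedAddCommGroup E]
    [NormedSpace ℝ E] [CompleteSpace E] {g : E → E} {K : NNReal} (hg : LipschitzWith K g)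
    {a b : ℝ} (hab : a ≤ b) (x : E) :
    ∃ γ : ℝ → E, ContinuousOn γ (Icc a b) ∧ γ b = x ∧
      ∀ s ∈ Icc a b, γ s = γ a + ∫ r in a..s, g (γ r) := by
  obtain ⟨k, hk⟩ := exists_nat_ge (2 * (K * (b - a)))
  replace hk : K * (b - a) ≤ k / 2 := by linarith
  induction k generalizing a b x with
  | zero =>
    exact exists_backward_integral_curve_of_mul_le hg hab (by norm_num at hk ⊢; linarith) x
  | succ k ih =>
    have hk1 : (0 : ℝ) < k + 1 := by positivity
    have hba : 0 ≤ b - a := sub_nonneg.2 hab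
    push_cast at hk
    set c : ℝ := a + (b - a) * (k / (k + 1)) with hc
    have hac : a ≤ c := by
      have : 0 ≤ (b - a) * (k / (k + 1)) := by positivity
      linarith
    have hbc : b - c = (b - a) / (k + 1) := by rw [hc]; field_simp; ring
    have hcb : c ≤ b := by
      have : 0 ≤ (b - a) / (k + 1) := by positivity
      linarith
    have hK2 : K * (b - c) ≤ 1 / 2 := by
      rw [hbc, ← mul_div_assoc, div_le_iff₀ hk1]
      linarith
    have hK1 : K * (c - a) ≤ k / 2 := by
      have : K * (c - a) = K * (b - a) * (k / (k + 1)) := by rw [hc]; ring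
      rw [this]
      calc K * (b - a) * (k / (k + 1)) ≤ (k + 1) / 2 * (k / (k + 1)) := by gcongr
        _ = k / 2 := by field_simp
    obtain ⟨γ₂, hc₂, hb₂, hi₂⟩ := exists_backward_integral_curve_of_mul_le hg hcb hK2 x
    obtain ⟨γ₁, hc₁, hb₁, hi₁⟩ := ih hac (γ₂ c) hK1
    let γ : ℝ → E := fun s => if s ≤ c then γ₁ s else γ₂ s
    have e₁ : EqOn γ γ₁ (Icc a c) := fun s hs => if_pos hs.2
    have e₂ : EqOn γ γ₂ (Icc c b) := fun s hs => by
      rcases hs.1.eq_or_lt with rfl | h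
      · simp [γ, hb₁]
      · exact if_neg (not_le.2 h)
    have hγ₁ : ContinuousOn γ (Icc a c) := hc₁.congr e₁
    have hγ₂ : ContinuousOn γ (Icc c b) := hc₂.congr e₂
    have I₁ : ∀ s ∈ Icc a c, γ s = γ a + ∫ r in a..s, g (γ r) := fun s hs => by
      rw [e₁ hs, e₁ (left_mem_Icc.2 hac), hi₁ s hs]
      congr 1
      refine intervalIntegral.integral_congr fun r hr => ?_
      rw [uIcc_of_le hs.1] at hr
      simp only [e₁ ⟨hr.1, hr.2.trans hs.2⟩]
    have I₂ : ∀ s ∈ Icc c b, γ s = γ c + ∫ r in c..s, g (γ r) := fun s hs => by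
      rw [e₂ hs, e₂ (left_mem_Icc.2 hcb), hi₂ s hs]
      congr 1
      refine intervalIntegral.integral_congr fun r hr => ?_
      rw [uIcc_of_le hs.1] at hr
      simp only [e₂ ⟨hr.1, hr.2.trans hs.2⟩]
    refine ⟨γ, ?_, ?_, fun s hs => ?_⟩
    · rw [← Icc_union_Icc_eq_Icc hac hcb]
      exact hγ₁.union_of_isClosed hγ₂ isClosed_Icc isClosed_Icc
    · rw [e₂ (right_mem_Icc.2 hcb), hb₂]
    · rcases le_total s c with h | h
      · exact I₁ s ⟨hs.1, h⟩
      · rw [I₂ s ⟨h, hs.2⟩, I₁ c (right_mem_Icc.2 hac), add_assoc,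
          intervalIntegral.integral_add_adjacent_intervals]
        · exact (hg.continuous.comp_continuousOn hγ₁).intervalIntegrable_of_Icc hac
        · exact (hg.continuous.comp_continuousOn
            (hγ₂.mono (Icc_subset_Icc_right hs.2))).intervalIntegrable_of_Icc h

/-- Grönwall's inequality in integral form. -/
lemma le_gronwallBound_of_le_integral {g : ℝ → ℝ} (hg : Continuous g) {δ K ε c : ℝ} (hK : 0 ≤ K)
    (h : ∀ r ∈ Icc 0 c, g r ≤ δ + ∫ τ in (0:ℝ)..r, (K * g τ + ε)) :
    ∀ r ∈ Icc 0 c, g r ≤ gronwallBound δ K ε r := by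
  have hc : Continuous fun τ => K * g τ + ε := by fun_prop
  have hd : ∀ r, HasDerivAt (fun r => δ + ∫ τ in (0:ℝ)..r, (K * g τ + ε)) (K * g r + ε) r :=
    fun r => (intervalIntegral.integral_hasDerivAt_right (hc.intervalIntegrable _ _)
      (hc.stronglyMeasurableAtFilter _ _) hc.continuousAt).const_add δ
  intro r hr
  refine (h r hr).trans ?_
  have := le_gronwallBound_of_liminf_deriv_right_le (a := 0) (b := c) (δ := δ) (K := K) (ε := ε)
    (f := fun r => δ + ∫ τ in (0:ℝ)..r, (K * g τ + ε)) (f' := fun r => K * g r + ε)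
    (fun r _ => (hd r).continuousAt.continuousWithinAt)
    (fun r _ q hq => (hd r).hasDerivWithinAt.liminf_right_slope_le hq) (by simp)
    (fun r hr => by
      have := mul_le_mul_of_nonneg_left (h r (Ico_subset_Icc_self hr)) hK
      linarith) r hr
  simpa using this

/-- Continuous functions of state, control and time are integrable along admissible pairs. -/
lemma IsAdmissible.intervalIntegrable {n m : ℕ} {f : En n → En m → En n} {U : Set (En m)}
    {a b : ℝ} {u : ℝ → En m} {γ : ℝ → En n} (h : IsAdmissible f U a b u γ) (hU : IsCompact U)
    {F : Type*} [NormedAddCommGroup F] {G : En n × En m × ℝ → F}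
    (hG : Continuous G) {c d : ℝ} (hac : a ≤ c) (hcd : c ≤ d) (hdb : d ≤ b) :
    IntervalIntegrable (fun s => G (γ s, u s, s)) volume c d := by
  obtain ⟨hu, huU, hγ, -⟩ := h
  have hsub : Icc c d ⊆ Icc a b := Icc_subset_Icc hac hdb
  rw [intervalIntegrable_iff_integrableOn_Icc_of_le hcd]
  have hcomp : IsCompact ((γ '' Icc a b) ×ˢ U ×ˢ Icc a b) :=
    (isCompact_Icc.image_of_continuousOn hγ).prod (hU.prod isCompact_Icc)
  obtain ⟨C, hC⟩ := hcomp.exists_bound_of_continuousOn hG.continuousOn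
  refine IntegrableOn.of_bound (by simp) ?_ C ?_
  · refine hG.comp_aestronglyMeasurable ?_
    exact ((hγ.mono hsub).aestronglyMeasurable measurableSet_Icc).prodMk
      (hu.aestronglyMeasurable.prodMk measurable_id.aestronglyMeasurable)
  · refine (ae_restrict_iff' measurableSet_Icc).2 (.of_forall fun s hs => ?_)
    exact hC _ ⟨mem_image_of_mem _ (hsub hs), huU s (hsub hs), hsub hs⟩

lemma IsAdmissible.eq_add_integral {n m : ℕ} {f : En n → En m → En n} {U : Set (En m)}
    {a b : ℝ} {u : ℝ → En m} {γ : ℝ → En n} (h : IsAdmissible f U a b u γ) (hU : IsCompact U)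
    (hf : Continuous fun p : En n × En m => f p.1 p.2) {s : ℝ} (hs : s ∈ Icc a b) :
    γ b = γ s + ∫ r in s..b, f (γ r) (u r) := by
  have hG : Continuous fun p : En n × En m × ℝ => f p.1 p.2.1 :=
    hf.comp (continuous_fst.prodMk continuous_snd.fst)
  rw [h.2.2.2 b (right_mem_Icc.2 (hs.1.trans hs.2)), h.2.2.2 s hs, add_assoc,
    intervalIntegral.integral_add_adjacent_intervals
      (h.intervalIntegrable hU hG le_rfl hs.1 hs.2)
      (h.intervalIntegrable hU hG hs.1 hs.2 le_rfl)]

lemma IsAdmissible.restrict {n m : ℕ} {f : En n → En m → En n} {U : Set (En m)}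
    {a b c : ℝ} {u : ℝ → En m} {γ : ℝ → En n} (h : IsAdmissible f U a b u γ) (hcb : c ≤ b) :
    IsAdmissible f U a c u γ :=
  have hsub : Icc a c ⊆ Icc a b := Icc_subset_Icc_right hcb
  ⟨h.1, fun s hs => h.2.1 s (hsub hs), h.2.2.1.mono hsub, fun s hs => h.2.2.2 s (hsub hs)⟩

/-- A priori bound for trajectories with prescribed terminal state. -/
lemma IsAdmissible.norm_le {n m : ℕ} {f : En n → En m → En n} {U : Set (En m)}
    {a b : ℝ} {u : ℝ → En m} {γ : ℝ → En n} (h : IsAdmissible f U a b u γ) (hU : IsCompact U)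
    (hf : Continuous fun p : En n × En m => f p.1 p.2) {K M : ℝ} (hK : 0 ≤ K) (hM0 : 0 ≤ M)
    (hA1 : ∀ x u, ‖f x u‖ ≤ K * (1 + ‖x‖ + ‖u‖)) (hM : ∀ v ∈ U, ‖v‖ ≤ M)
    {s : ℝ} (hs : s ∈ Icc a b) :
    ‖γ s‖ ≤ gronwallBound ‖γ b‖ K (K * (1 + M)) (b - a) := by
  have hab : a ≤ b := hs.1.trans hs.2
  let γ' : ℝ → En n := IccExtend hab ((Icc a b).domRestrict γ)
  have hγ' : Continuous γ' := (continuousOn_iff_continuous_domRestrict.1 h.2.2.1).Icc_extend'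
  have e : ∀ r ∈ Icc a b, γ' r = γ r := fun r hr => by
    simp [γ', IccExtend_of_mem hab _ hr, domRestrict_apply]
  let g : ℝ → ℝ := fun r => ‖γ' (b - r)‖
  have hg : Continuous g := by fun_prop
  have key : ∀ r ∈ Icc 0 (b - a), g r ≤ ‖γ b‖ + ∫ τ in (0:ℝ)..r, (K * g τ + K * (1 + M)) := by
    intro r hr
    have hr' : b - r ∈ Icc a b := ⟨by linarith [hr.2], by linarith [hr.1]⟩
    have h1 := h.eq_add_integral hU hf hr'
    have h2 : ‖∫ τ in (b - r)..b, f (γ τ) (u τ)‖ ≤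
        ∫ τ in (b - r)..b, (K * ‖γ' τ‖ + K * (1 + M)) := by
      refine intervalIntegral.norm_integral_le_of_norm_le hr'.2 (.of_forall fun τ hτ => ?_)
        (Continuous.intervalIntegrable (by fun_prop) _ _)
      have hτ' : τ ∈ Icc a b := ⟨hr'.1.trans hτ.1.le, hτ.2⟩
      rw [e τ hτ']
      refine (hA1 _ _).trans ?_
      have := mul_le_mul_of_nonneg_left (hM _ (h.2.1 τ hτ')) hK
      linarith
    have h3 : ∫ τ in (0:ℝ)..r, (K * g τ + K * (1 + M)) =
        ∫ τ in (b - r)..b, (K * ‖γ' τ‖ + K * (1 + M)) := by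
      have := intervalIntegral.integral_comp_sub_left (a := 0) (b := r)
        (fun τ => K * ‖γ' τ‖ + K * (1 + M)) b
      simpa using this
    have h4 : γ (b - r) = γ b - ∫ τ in (b - r)..b, f (γ τ) (u τ) := by rw [h1]; abel
    have h5 : g r = ‖γ (b - r)‖ := by simp only [g, e _ hr']
    rw [h5, h4, h3]
    exact (norm_sub_le _ _).trans (by gcongr)
  have hbs : b - s ∈ Icc 0 (b - a) := ⟨by linarith [hs.2], by linarith [hs.1]⟩
  have h1 := le_gronwallBound_of_le_integral hg hK key (b - s) hbs
  have h2 : g (b - s) = ‖γ s‖ := by simp only [g, sub_sub_cancel, e _ hs]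
  rw [h2] at h1
  exact h1.trans (gronwallBound_mono (norm_nonneg _) (by positivity) hK hbs.2)

/-- The value function is bounded above by the cost of any admissible pair. -/
lemma valueFun_le {n m : ℕ} {f : En n → En m → En n} {U : Set (En m)} (hU : IsCompact U)
    (hf : Continuous fun p : En n × En m => f p.1 p.2) {K : ℝ} (hK : 0 ≤ K)
    (hA1 : ∀ x u, ‖f x u‖ ≤ K * (1 + ‖x‖ + ‖u‖)) {L : En n → En m → ℝ → ℝ}
    (hL : Continuous fun p : En n × En m × ℝ => L p.1 p.2.1 p.2.2)
    {I : En n → ℝ} (hI : Continuous I) {t : ℝ} (ht : 0 ≤ t)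
    {u : ℝ → En m} {γ : ℝ → En n} (h : IsAdmissible f U 0 t u γ) :
    valueFun f U L I t (γ t) ≤ (∫ s in (0:ℝ)..t, L (γ s) (u s) s) + I (γ 0) := by
  refine csInf_le ?_ ⟨u, γ, h, rfl, rfl⟩
  obtain ⟨M, hM0, hM⟩ := hU.isBounded.exists_pos_norm_le
  set R := gronwallBound ‖γ t‖ K (K * (1 + M)) (t - 0)
  obtain ⟨C, hC⟩ := (isCompact_closedBall (0 : En n) R).exists_bound_of_continuousOn hI.continuousOn
  obtain ⟨D, hD⟩ := ((isCompact_closedBall (0 : En n) R).prod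
    (hU.prod (isCompact_Icc (a := (0:ℝ)) (b := t)))).exists_bound_of_continuousOn hL.continuousOn
  refine ⟨-(D * t) - C, ?_⟩
  rintro J ⟨v, η, hη, hηt, rfl⟩
  have hball : ∀ s ∈ Icc 0 t, η s ∈ Metric.closedBall (0 : En n) R := fun s hs => by
    have := hη.norm_le hU hf hK hM0.le hA1 hM hs
    rw [hηt] at this
    exact mem_closedBall_zero_iff.2 this
  have h1 : ‖∫ s in (0:ℝ)..t, L (η s) (v s) s‖ ≤ D * |t - 0| := by
    refine intervalIntegral.norm_integral_le_of_norm_le_const fun s hs => ?_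
    rw [uIoc_of_le ht] at hs
    have hs' := Ioc_subset_Icc_self hs
    exact hD (η s, v s, s) ⟨hball s hs', hη.2.1 s hs', hs'⟩
  have h2 := hC _ (hball 0 (left_mem_Icc.2 ht))
  rw [sub_zero, abs_of_nonneg ht] at h1
  linarith [(abs_le.1 h1).1, (abs_le.1 h2).1]

/-- Near-optimal admissible pairs exist. -/
lemma exists_admissible_cost_lt {n m : ℕ} {f : En n → En m → En n} {U : Set (En m)}
    (hUne : U.Nonempty) {K : ℝ}
    (hA2 : ∀ x₁ x₂ u, u ∈ U → ‖f x₂ u - f x₁ u‖ ≤ K * ‖x₂ - x₁‖)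
    (L : En n → En m → ℝ → ℝ) (I : En n → ℝ) {t : ℝ} (ht : 0 ≤ t) (x : En n)
    {ε : ℝ} (hε : 0 < ε) :
    ∃ u γ, IsAdmissible f U 0 t u γ ∧ γ t = x ∧
      (∫ s in (0:ℝ)..t, L (γ s) (u s) s) + I (γ 0) < valueFun f U L I t x + ε := by
  obtain ⟨v, hv⟩ := hUne
  have hLip : LipschitzWith K.toNNReal fun y => f y v := by
    refine LipschitzWith.of_dist_le_mul fun y z => ?_
    rw [dist_eq_norm, dist_eq_norm]
    exact (hA2 z y v hv).trans (by gcongr; exact Real.le_coe_toNNReal K)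
  obtain ⟨γ, hγ, hγt, hγi⟩ := exists_backward_integral_curve hLip ht x
  have hne : { J | ∃ u γ, IsAdmissible f U 0 t u γ ∧ γ t = x ∧
      J = (∫ s in (0:ℝ)..t, L (γ s) (u s) s) + I (γ 0) }.Nonempty :=
    ⟨_, fun _ => v, γ, ⟨measurable_const, fun _ _ => hv, hγ, hγi⟩, hγt, rfl⟩
  obtain ⟨J, ⟨u, η, h1, h2, rfl⟩, hJ⟩ := Real.lt_sInf_add_pos hne hε
  exact ⟨u, η, h1, h2, hJ⟩

/-- The value function is a viscosity supersolution of the HJB equation. -/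
theorem value_function_viscosity_supersolution {n m : ℕ} (T : ℝ) (hT : 0 < T)
    (U : Set (En m)) (hU : IsCompact U) (hUne : U.Nonempty)
    (f : En n → En m → En n)
    (hf : Continuous fun p : En n × En m => f p.1 p.2)
    (K₀ : ℝ) (hK₀ : 0 < K₀)
    (hA1 : ∀ x u, ‖f x u‖ ≤ K₀ * (1 + ‖x‖ + ‖u‖))
    (K₁ : ℝ) (hK₁ : 0 < K₁)
    (hA2 : ∀ x₁ x₂ u, u ∈ U → ‖f x₂ u - f x₁ u‖ ≤ K₁ * ‖x₂ - x₁‖)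
    (L : En n → En m → ℝ → ℝ)
    (hL : Continuous fun p : En n × En m × ℝ => L p.1 p.2.1 p.2.2)
    (hL1 : ∀ K : ℝ, ∃ C : ℝ, ∀ x u t, u ∈ U → t ∈ Icc (0:ℝ) T →
      K * ‖u‖ - C ≤ L x u t)
    (hL2 : ∀ R > (0:ℝ), ∃ α : ℝ, ∀ x₁ x₂ u t, ‖x₁‖ ≤ R → ‖x₂‖ ≤ R → u ∈ U →
      t ∈ Icc (0:ℝ) T → |L x₂ u t - L x₁ u t| ≤ α * ‖x₂ - x₁‖)
    (hLu : ∃ C : ℝ, ∀ x u₁ u₂ t, u₁ ∈ U → u₂ ∈ U → t ∈ Icc (0:ℝ) T →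
      |L x u₁ t - L x u₂ t| ≤ C * ‖u₁ - u₂‖)
    (I : En n → ℝ) (hI : Continuous I)
    (φ : ℝ → En n → ℝ) (hφ : ContDiff ℝ 1 fun p : ℝ × En n => φ p.1 p.2)
    (t₀ : ℝ) (x₀ : En n) (ht₀ : t₀ ∈ Ioo 0 T)
    (hmin : IsLocalMin (fun p : ℝ × En n =>
      valueFun f U L I p.1 p.2 - φ p.1 p.2) (t₀, x₀)) :
    deriv (fun τ => φ τ x₀) t₀ + ham f U L x₀ (gradient (φ t₀) x₀) t₀ ≥ 0 := by
  have hq := (hφ.differentiable one_ne_zero (t₀, x₀)).hasFDerivAt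
  set F := fderiv ℝ (fun p : ℝ × En n => φ p.1 p.2) (t₀, x₀)
  have hdt : deriv (fun τ => φ τ x₀) t₀ = F (1, 0) := by
    have h1 : HasDerivAt (fun τ : ℝ => (τ, x₀)) ((1 : ℝ), (0 : En n)) t₀ :=
      (hasDerivAt_id t₀).prodMk (hasDerivAt_const t₀ x₀)
    exact (HasFDerivAt.comp_hasDerivAt (x := t₀) (f := fun τ : ℝ => (τ, x₀)) hq h1).deriv
  have hdx : ∀ v, F (0, v) = ⟪gradient (φ t₀) x₀, v⟫ := fun v => by
    have h1 : HasFDerivAt (φ t₀) (F.comp (ContinuousLinearMap.inr ℝ ℝ (En n))) x₀ :=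
      HasFDerivAt.comp (f := fun x : En n => (t₀, x)) x₀ hq (hasFDerivAt_prodMk_right t₀ x₀)
    rw [gradient, h1.fderiv, InnerProductSpace.toDual_symm_apply]
    simp
  rw [hdt]
  set p := gradient (φ t₀) x₀
  have hGc : Continuous fun q : En n × En m × ℝ => ⟪p, f q.1 q.2.1⟫ - L q.1 q.2.1 q.2.2 :=
    (continuous_const.inner (hf.comp (continuous_fst.prodMk continuous_snd.fst))).sub hL
  have hbdd : BddAbove { r | ∃ u ∈ U, r = ⟪p, f x₀ u⟫ - L x₀ u t₀ } := by
    have hc : Continuous fun u : En m => ⟪p, f x₀ u⟫ - L x₀ u t₀ :=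
      hGc.comp (continuous_const.prodMk (continuous_id.prodMk continuous_const))
    refine (hU.image hc).bddAbove.mono ?_
    rintro _ ⟨u, hu, rfl⟩
    exact ⟨u, hu, rfl⟩
  have hham : ∀ u ∈ U, ⟪p, f x₀ u⟫ - L x₀ u t₀ ≤ ham f U L x₀ p t₀ := fun u hu =>
    le_csSup hbdd ⟨u, hu, rfl⟩
  obtain ⟨M, hM0, hM⟩ := hU.isBounded.exists_pos_norm_le
  set R := gronwallBound ‖x₀‖ K₀ (K₀ * (1 + M)) (t₀ - 0)
  set B := 1 + K₀ * (1 + |R| + M)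
  have hB1 : 1 ≤ B := by
    have : 0 ≤ K₀ * (1 + |R| + M) := by positivity
    linarith
  have hB0 : 0 < B := by linarith
  refine ge_iff_le.2 (le_of_forall_pos_le_add fun ε' hε' => ?_)
  set ε := ε' / 3 with hεdef
  have hε : 0 < ε := by positivity
  have hlittle := hq.isLittleO.bound (div_pos hε hB0)
  have hunif : ∀ᶠ q : ℝ × En n in nhds (t₀, x₀), ∀ u ∈ U,
      ⟪p, f q.2 u⟫ - L q.2 u q.1 < ⟪p, f x₀ u⟫ - L x₀ u t₀ + ε := by
    refine hU.eventually_forall_of_forall_eventually fun u _ => ?_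
    have c1 : Continuous fun z : (ℝ × En n) × En m => ⟪p, f z.1.2 z.2⟫ - L z.1.2 z.2 z.1.1 :=
      hGc.comp (continuous_fst.snd.prodMk (continuous_snd.prodMk continuous_fst.fst))
    have c2 : Continuous fun z : (ℝ × En n) × En m => ⟪p, f x₀ z.2⟫ - L x₀ z.2 t₀ + ε :=
      (hGc.comp (continuous_const.prodMk (continuous_snd.prodMk continuous_const))).add
        continuous_const
    exact c1.continuousAt.eventually_lt c2.continuousAt (lt_add_of_pos_right _ hε)
  obtain ⟨ρ, hρ, hball⟩ := Metric.eventually_nhds_iff.1 (hmin.and (hlittle.and hunif))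
  obtain ⟨h, h0, hht, hhρ⟩ : ∃ h : ℝ, 0 < h ∧ h ≤ t₀ ∧ B * h < ρ := by
    refine ⟨min t₀ (ρ / (2 * B)), lt_min ht₀.1 (by positivity), min_le_left _ _, ?_⟩
    calc B * min t₀ (ρ / (2 * B)) ≤ B * (ρ / (2 * B)) := by gcongr; exact min_le_right _ _
      _ = ρ / 2 := by field_simp
      _ < ρ := by linarith
  obtain ⟨u, γ, hγ, hγt, hcost⟩ :=
    exists_admissible_cost_lt hUne hA2 L I ht₀.1.le x₀ (mul_pos hε h0)
  have hγR : ∀ s ∈ Icc 0 t₀, ‖γ s‖ ≤ |R| := fun s hs => by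
    have := hγ.norm_le hU hf hK₀.le hM0.le hA1 hM hs
    rw [hγt] at this
    exact this.trans (le_abs_self R)
  have hth : t₀ - h ∈ Icc 0 t₀ := ⟨by linarith, by linarith⟩
  have hspeed : ∀ s ∈ Icc (t₀ - h) t₀, ‖γ s - x₀‖ ≤ B * h := fun s hs => by
    have hs0 : s ∈ Icc 0 t₀ := ⟨hth.1.trans hs.1, hs.2⟩
    have h1 := hγ.eq_add_integral hU hf hs0
    have h2 : ‖∫ r in s..t₀, f (γ r) (u r)‖ ≤ B * |t₀ - s| := by
      refine intervalIntegral.norm_integral_le_of_norm_le_const fun r hr => ?_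
      rw [uIoc_of_le hs.2] at hr
      have hr0 : r ∈ Icc 0 t₀ := ⟨hs0.1.trans hr.1.le, hr.2⟩
      calc ‖f (γ r) (u r)‖ ≤ K₀ * (1 + ‖γ r‖ + ‖u r‖) := hA1 _ _
        _ ≤ K₀ * (1 + |R| + M) := by
          gcongr
          exacts [hγR r hr0, hM _ (hγ.2.1 r hr0)]
        _ ≤ B := by linarith
    have h3 : γ s - x₀ = -∫ r in s..t₀, f (γ r) (u r) := by rw [← hγt, h1]; abel
    rw [h3, norm_neg]
    refine h2.trans ?_
    rw [abs_of_nonneg (by linarith [hs.2])]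
    gcongr
    linarith [hs.1]
  have hnorm : ∀ s ∈ Icc (t₀ - h) t₀, ‖(s, γ s) - (t₀, x₀)‖ ≤ B * h := fun s hs => by
    rw [Prod.mk_sub_mk, Prod.norm_mk]
    refine max_le ?_ (hspeed s hs)
    rw [Real.norm_eq_abs, abs_le]
    constructor <;> nlinarith [hs.1, hs.2]
  have hdist : ∀ s ∈ Icc (t₀ - h) t₀, dist (s, γ s) (t₀, x₀) < ρ := fun s hs => by
    rw [dist_eq_norm]
    exact (hnorm s hs).trans_lt hhρ
  have hleft : t₀ - h ∈ Icc (t₀ - h) t₀ := ⟨le_rfl, by linarith⟩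
  obtain ⟨m1, m2, -⟩ := hball (hdist _ hleft)
  have hsplit : (∫ s in (0:ℝ)..t₀, L (γ s) (u s) s) =
      (∫ s in (0:ℝ)..(t₀ - h), L (γ s) (u s) s) + ∫ s in (t₀ - h)..t₀, L (γ s) (u s) s :=
    (intervalIntegral.integral_add_adjacent_intervals
      (hγ.intervalIntegrable hU hL le_rfl hth.1 hth.2)
      (hγ.intervalIntegrable hU hL hth.1 hth.2 le_rfl)).symm
  have hV := valueFun_le hU hf hK₀.le hA1 hL hI hth.1 (hγ.restrict hth.2)
  have hfint : IntervalIntegrable (fun s => f (γ s) (u s)) volume (t₀ - h) t₀ :=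
    hγ.intervalIntegrable hU (G := fun q : En n × En m × ℝ => f q.1 q.2.1)
      (hf.comp (continuous_fst.prodMk continuous_snd.fst)) hth.1 hth.2 le_rfl
  have hinner : ⟪p, ∫ s in (t₀ - h)..t₀, f (γ s) (u s)⟫ =
      ∫ s in (t₀ - h)..t₀, ⟪p, f (γ s) (u s)⟫ :=
    ((innerSL ℝ p).intervalIntegral_comp_comm hfint).symm
  have hGint : (∫ s in (t₀ - h)..t₀, ⟪p, f (γ s) (u s)⟫) - ∫ s in (t₀ - h)..t₀, L (γ s) (u s) s ≤
      h * (ham f U L x₀ p t₀ + ε) := by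
    rw [← intervalIntegral.integral_sub
      (hγ.intervalIntegrable hU (G := fun q : En n × En m × ℝ => ⟪p, f q.1 q.2.1⟫)
        (continuous_const.inner (hf.comp (continuous_fst.prodMk continuous_snd.fst)))
        hth.1 hth.2 le_rfl)
      (hγ.intervalIntegrable hU hL hth.1 hth.2 le_rfl)]
    have := intervalIntegral.integral_mono_on hth.2
      (hγ.intervalIntegrable hU hGc hth.1 hth.2 le_rfl)
      (intervalIntegrable_const (c := ham f U L x₀ p t₀ + ε)) fun s hs => by
        have hus := hγ.2.1 s ⟨hth.1.trans hs.1, hs.2⟩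
        have h1 := (hball (hdist s hs)).2.2 _ hus
        have h2 := hham _ hus
        simp only at h1 ⊢
        linarith
    rw [intervalIntegral.integral_const, sub_sub_cancel, smul_eq_mul] at this
    exact this
  have hF' : F ((t₀ - h, γ (t₀ - h)) - (t₀, x₀)) =
      -(h * F (1, 0)) - ⟪p, ∫ s in (t₀ - h)..t₀, f (γ s) (u s)⟫ := by
    have h1 := hγ.eq_add_integral hU hf hth
    have h2 : (t₀ - h, γ (t₀ - h)) - (t₀, x₀) = (-h) • ((1 : ℝ), (0 : En n)) -
        ((0 : ℝ), ∫ s in (t₀ - h)..t₀, f (γ s) (u s)) := by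
      rw [← hγt, h1]
      ext1 <;> simp
    rw [h2, map_sub, map_smul, hdx, smul_eq_mul]
    ring
  have m3 := m2.trans (mul_le_mul_of_nonneg_left (hnorm _ hleft) (by positivity))
  have m4 : ε / B * (B * h) = ε * h := by field_simp
  rw [m4, hF', hinner, Real.norm_eq_abs] at m3
  have m5 := (abs_le.1 m3).1
  simp only at m1 m5
  have m6 : 0 ≤ h * (F (1, 0) + ham f U L x₀ p t₀ + ε') := by
    have : ε' = 3 * ε := by rw [hεdef]; ring
    rw [this]
    linarith
  exact nonneg_of_mul_nonneg_right m6 h0
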